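/- A shift-invariant tail measure is determined by its spectral tail process: if ν and ν' are shift-invariant tail measures with the same index α > 0 on E^ℤ whose spectral tail processes have the same law, then ν = ν'. -/

import Mathlib

open MeasureTheory
open scoped ENNReal

/-- A measurable cone: a measurable space `E` with a measurable multiplication by positive
scalars, a zero element and a measurable `1`-homogeneous pseudonorm. -/
structure MeasCone (E : Type*) [MeasurableSpace E] where
  smul : ℝ → E → E
  zero : E
  nrm : E → ℝ
  measurable_smul : Measurable fun p : ℝ × E => smul p.1 p.2
  measurable_nrm : Measurable nrm
  one_smul : ∀ x, smul 1 x = x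
  smul_smul : ∀ (u v : ℝ), 0 < u → 0 < v → ∀ x, smul u (smul v x) = smul (u * v) x
  smul_zero' : ∀ (u : ℝ), 0 < u → smul u zero = zero
  nrm_nonneg : ∀ x, 0 ≤ nrm x
  nrm_smul : ∀ (u : ℝ), 0 < u → ∀ x, nrm (smul u x) = u * nrm x
  eq_zero_of_nrm : ∀ x, nrm x = 0 → x = zero

/-- The `k`-th iterate of the backshift operator: `(B^k x)_h = x_{h-k}`. -/
def seqShift {E : Type*} (k : ℤ) (x : ℤ → E) : ℤ → E := fun h => x (h - k)

/-- Shift invariance of a measure on `E^ℤ`: `ν(BA) = ν(A)` for all measurable `A`. -/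
def ShiftInvariant {E : Type*} [MeasurableSpace E] (ν : MeasureTheory.Measure (ℤ → E)) : Prop :=
  ∀ A : Set (ℤ → E), MeasurableSet A → ν (seqShift 1 '' A) = ν A

namespace MeasCone

variable {E : Type*} [MeasurableSpace E] (K : MeasCone E)

/-- The sequence identically equal to the zero element. -/
def zeroSeq : ℤ → E := fun _ => K.zero

/-- Componentwise scalar multiplication on the sequence space `E^ℤ`. -/
def sSmul (u : ℝ) (x : ℤ → E) : ℤ → E := fun h => K.smul u (x h)


/-- A tail measure with index `α > 0` on `E^ℤ`. -/
def IsTailMeasure (α : ℝ) (ν : Measure (ℤ → E)) : Prop :=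
  ν {K.zeroSeq} = 0 ∧
  ν {x | 1 < K.nrm (x 0)} = 1 ∧
  (∀ h : ℤ, ν {x | 1 < K.nrm (x h)} < ⊤) ∧
  ∀ (u : ℝ), 0 < u → ∀ A : Set (ℤ → E), MeasurableSet A →
    ν (K.sSmul u '' A) = ENNReal.ofReal (u ^ (-α)) * ν A

/-- The spectral map at lag `h`: `x ↦ x / ‖x_h‖`. -/
noncomputable def spectralMap (h : ℤ) (x : ℤ → E) : ℤ → E :=
  fun j => K.smul (K.nrm (x h))⁻¹ (x j)

/-- The law of the local spectral tail process of `ν` at lag `h`: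
the pushforward under the spectral map of (the normalization of) the restriction of `ν`
to `{x : ‖x_h‖ > 1}`. -/
noncomputable def spectralLaw (ν : Measure (ℤ → E)) (h : ℤ) : Measure (ℤ → E) :=
  Measure.map (K.spectralMap h)
    ((ν {x | 1 < K.nrm (x h)})⁻¹ • ν.restrict {x | 1 < K.nrm (x h)})

/-- The time change formula for (the law of) a process `Θ`:
`E[H₀(B^h Θ)] = E[‖Θ_h‖^α H₀(Θ)]` for every measurable `0`-homogeneous
`H₀ : E^ℤ → [0,∞)` vanishing on `{x : ‖x_0‖ = 0}`. -/
def SatisfiesTCF (α : ℝ) (μ : Measure (ℤ → E)) : Prop :=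
  ∀ (h : ℤ) (H : (ℤ → E) → ℝ), Measurable H → (∀ x, 0 ≤ H x) →
    (∀ (u : ℝ), 0 < u → ∀ x, H (K.sSmul u x) = H x) →
    (∀ x, K.nrm (x 0) = 0 → H x = 0) →
    ∫⁻ x, ENNReal.ofReal (H (seqShift h x)) ∂μ
      = ∫⁻ x, ENNReal.ofReal (K.nrm (x h) ^ α) * ENNReal.ofReal (H x) ∂μ

/-- `I(x) = j ∈ ℤ` for the infargmax functional:
`sup_{k ≤ j-1} ‖x_k‖ < ‖x_j‖ = sup_{k ∈ ℤ} ‖x_k‖`. -/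
def IsInfArgmax (x : ℤ → E) (j : ℤ) : Prop :=
  (⨆ k : ℤ, ⨆ _ : k < j, ENNReal.ofReal (K.nrm (x k))) < ENNReal.ofReal (K.nrm (x j)) ∧
  ENNReal.ofReal (K.nrm (x j)) = ⨆ k : ℤ, ENNReal.ofReal (K.nrm (x k))

end MeasCone

namespace MeasCone

variable {E : Type*} [MeasurableSpace E] (K : MeasCone E)

lemma measurable_sSmul (u : ℝ) : Measurable (K.sSmul u) :=
  measurable_pi_lambda _ fun h =>
    K.measurable_smul.comp (measurable_const.prodMk (measurable_pi_apply h))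

lemma measurable_nrm_apply (h : ℤ) : Measurable fun x : ℤ → E => K.nrm (x h) :=
  K.measurable_nrm.comp (measurable_pi_apply h)

lemma measurable_spectralMap (h : ℤ) : Measurable (K.spectralMap h) :=
  measurable_pi_lambda _ fun j =>
    K.measurable_smul.comp ((K.measurable_nrm_apply h).inv.prodMk (measurable_pi_apply j))

lemma measurable_uncurry_sSmul :
    Measurable fun p : ℝ × (ℤ → E) => K.sSmul p.1 p.2 :=
  measurable_pi_lambda _ fun h =>
    K.measurable_smul.comp
      (measurable_fst.prodMk ((measurable_pi_apply h).comp measurable_snd))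

lemma measurable_seqShift (k : ℤ) : Measurable (seqShift k : (ℤ → E) → ℤ → E) :=
  measurable_pi_lambda _ fun h => measurable_pi_apply (h - k)

lemma measurableSet_lt_nrm (r : ℝ) (h : ℤ) : MeasurableSet {x : ℤ → E | r < K.nrm (x h)} :=
  measurableSet_lt measurable_const (K.measurable_nrm_apply h)

lemma sSmul_sSmul {u v : ℝ} (hu : 0 < u) (hv : 0 < v) (x : ℤ → E) :
    K.sSmul u (K.sSmul v x) = K.sSmul (u * v) x :=
  funext fun h => K.smul_smul u v hu hv (x h)

lemma one_sSmul (x : ℤ → E) : K.sSmul 1 x = x :=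
  funext fun h => K.one_smul (x h)

lemma sSmul_inv_sSmul {u : ℝ} (hu : 0 < u) (x : ℤ → E) :
    K.sSmul u⁻¹ (K.sSmul u x) = x := by
  rw [K.sSmul_sSmul (inv_pos.2 hu) hu, inv_mul_cancel₀ hu.ne', K.one_sSmul]

lemma sSmul_sSmul_inv {u : ℝ} (hu : 0 < u) (x : ℤ → E) :
    K.sSmul u (K.sSmul u⁻¹ x) = x := by
  rw [K.sSmul_sSmul hu (inv_pos.2 hu), mul_inv_cancel₀ hu.ne', K.one_sSmul]

lemma nrm_sSmul {u : ℝ} (hu : 0 < u) (x : ℤ → E) (h : ℤ) :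
    K.nrm (K.sSmul u x h) = u * K.nrm (x h) :=
  K.nrm_smul u hu (x h)

lemma spectralMap_sSmul {u : ℝ} (hu : 0 < u) {x : ℤ → E} {h : ℤ} (hx : 0 < K.nrm (x h)) :
    K.spectralMap h (K.sSmul u x) = K.spectralMap h x := by
  funext j
  change K.smul (K.nrm (K.sSmul u x h))⁻¹ (K.smul u (x j)) = K.smul (K.nrm (x h))⁻¹ (x j)
  rw [K.nrm_sSmul hu, K.smul_smul _ _ (by positivity) hu]
  congr 1
  field_simp

lemma sSmul_nrm_spectralMap {x : ℤ → E} {h : ℤ} (hx : 0 < K.nrm (x h)) :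
    K.sSmul (K.nrm (x h)) (K.spectralMap h x) = x :=
  K.sSmul_sSmul_inv hx x

namespace IsTailMeasure

variable {K} {α : ℝ} {ν : Measure (ℤ → E)}

lemma measure_preimage_sSmul (hν : K.IsTailMeasure α ν) {u : ℝ} (hu : 0 < u)
    {A : Set (ℤ → E)} (hA : MeasurableSet A) :
    ν (K.sSmul u ⁻¹' A) = ENNReal.ofReal (u ^ α) * ν A := by
  have h := hν.2.2.2 u⁻¹ (inv_pos.2 hu) A hA
  rwa [Set.image_eq_preimage_of_inverse (K.sSmul_sSmul_inv hu) (K.sSmul_inv_sSmul hu),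
    Real.inv_rpow hu.le, Real.rpow_neg hu.le, inv_inv] at h

/-- Scaling reduces the exceedances of a level `r > 0` to those of level `1`. -/
lemma measure_lt_nrm_inter (hν : K.IsTailMeasure α ν) {r : ℝ} (hr : 0 < r) (h : ℤ)
    {A : Set (ℤ → E)} (hA : MeasurableSet A) :
    ν (A ∩ {x | r < K.nrm (x h)}) =
      (ENNReal.ofReal (r ^ α))⁻¹ * ν (K.sSmul r ⁻¹' A ∩ {x | 1 < K.nrm (x h)}) := by
  have hset : K.sSmul r ⁻¹' (A ∩ {x | r < K.nrm (x h)}) =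
      K.sSmul r ⁻¹' A ∩ {x | 1 < K.nrm (x h)} := by
    ext x
    simp [K.nrm_sSmul hr, hr]
  rw [← hset, hν.measure_preimage_sSmul hr (hA.inter (K.measurableSet_lt_nrm r h)), ← mul_assoc,
    ENNReal.inv_mul_cancel (by simpa using Real.rpow_pos_of_pos hr α) ENNReal.ofReal_ne_top,
    one_mul]

lemma spectralLaw_apply (hν : K.IsTailMeasure α ν) {C : Set (ℤ → E)} (hC : MeasurableSet C) :
    K.spectralLaw ν 0 C = ν (K.spectralMap 0 ⁻¹' C ∩ {x | 1 < K.nrm (x 0)}) := by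
  rw [spectralLaw, hν.2.1, Measure.map_apply (K.measurable_spectralMap 0) hC, inv_one,
    _root_.one_smul,
    Measure.restrict_apply (K.measurable_spectralMap 0 hC)]

/-- The radial part and the spectral part are independent, and the radial part is Pareto. -/
lemma measure_spectralMap_inter (hν : K.IsTailMeasure α ν) {C : Set (ℤ → E)}
    (hC : MeasurableSet C) (r : ℝ) :
    ν (K.spectralMap 0 ⁻¹' C ∩ {x | r < K.nrm (x 0)} ∩ {x | 1 < K.nrm (x 0)}) =
      (ENNReal.ofReal (max r 1 ^ α))⁻¹ * K.spectralLaw ν 0 C := by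
  have hpos : 0 < max r 1 := lt_max_of_lt_right one_pos
  have hset : K.spectralMap 0 ⁻¹' C ∩ {x | r < K.nrm (x 0)} ∩ {x | 1 < K.nrm (x 0)} =
      K.spectralMap 0 ⁻¹' C ∩ {x | max r 1 < K.nrm (x 0)} := by
    ext x
    simp [and_assoc]
  rw [hset, hν.measure_lt_nrm_inter hpos 0 (K.measurable_spectralMap 0 hC),
    hν.spectralLaw_apply hC]
  congr 2
  ext x
  simp only [Set.mem_inter_iff, Set.mem_preimage, Set.mem_ofPred_eq, and_congr_left_iff]
  intro hx
  rw [K.spectralMap_sSmul hpos (one_pos.trans hx)]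

lemma restrict_lt_nrm_eq {ν' : Measure (ℤ → E)} (hν : K.IsTailMeasure α ν)
    (hν' : K.IsTailMeasure α ν') (hspec : K.spectralLaw ν 0 = K.spectralLaw ν' 0) :
    ν.restrict {x | 1 < K.nrm (x 0)} = ν'.restrict {x | 1 < K.nrm (x 0)} := by
  have hU := K.measurableSet_lt_nrm 1 0
  have : IsFiniteMeasure (ν.restrict {x | 1 < K.nrm (x 0)}) := ⟨by simp [hν.2.1]⟩
  have : IsFiniteMeasure (ν'.restrict {x | 1 < K.nrm (x 0)}) := ⟨by simp [hν'.2.1]⟩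
  have hT : Measurable fun x : ℤ → E => (K.nrm (x 0), K.spectralMap 0 x) :=
    (K.measurable_nrm_apply 0).prodMk (K.measurable_spectralMap 0)
  have hmap : (ν.restrict {x | 1 < K.nrm (x 0)}).map (fun x => (K.nrm (x 0), K.spectralMap 0 x)) =
      (ν'.restrict {x | 1 < K.nrm (x 0)}).map (fun x => (K.nrm (x 0), K.spectralMap 0 x)) := by
    refine Measure.ext_prod fun {s C} hs hC => ?_
    have hCm := K.measurable_spectralMap 0 hC
    have key : ((ν.restrict {x | 1 < K.nrm (x 0)}).restrict (K.spectralMap 0 ⁻¹' C)).map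
          (fun x => K.nrm (x 0)) =
        ((ν'.restrict {x | 1 < K.nrm (x 0)}).restrict (K.spectralMap 0 ⁻¹' C)).map
          (fun x => K.nrm (x 0)) := by
      refine ext_of_generate_finite _ (BorelSpace.measurable_eq.trans (borel_eq_generateFrom_Ioi ℝ))
        isPiSystem_Ioi ?_ ?_
      swap
      · rw [Measure.map_apply (K.measurable_nrm_apply 0) MeasurableSet.univ,
          Measure.map_apply (K.measurable_nrm_apply 0) MeasurableSet.univ, Set.preimage_univ,
          Measure.restrict_apply_univ, Measure.restrict_apply_univ,
          Measure.restrict_apply hCm, Measure.restrict_apply hCm,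
          ← hν.spectralLaw_apply hC, ← hν'.spectralLaw_apply hC, hspec]
      rintro _ ⟨r, rfl⟩
      have hr := K.measurable_nrm_apply 0 (measurableSet_Ioi (a := r))
      rw [Measure.map_apply (K.measurable_nrm_apply 0) measurableSet_Ioi,
        Measure.map_apply (K.measurable_nrm_apply 0) measurableSet_Ioi,
        Measure.restrict_apply hr, Measure.restrict_apply hr,
        Measure.restrict_apply (hr.inter hCm), Measure.restrict_apply (hr.inter hCm),
        Set.inter_comm _ (K.spectralMap 0 ⁻¹' C)]
      exact (hν.measure_spectralMap_inter hC r).trans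
        (hspec ▸ (hν'.measure_spectralMap_inter hC r).symm)
    have hs' := K.measurable_nrm_apply 0 hs
    have := congrArg (fun m => m s) key
    simp only [Measure.map_apply (K.measurable_nrm_apply 0) hs, Measure.restrict_apply hs'] at this
    rw [Measure.map_apply hT (hs.prod hC), Measure.map_apply hT (hs.prod hC)]
    exact this
  have hinv : ∀ μ : Measure (ℤ → E), ((μ.restrict {x | 1 < K.nrm (x 0)}).map
      (fun x => (K.nrm (x 0), K.spectralMap 0 x))).map (fun p => K.sSmul p.1 p.2) =
      μ.restrict {x | 1 < K.nrm (x 0)} := by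
    intro μ
    rw [Measure.map_map K.measurable_uncurry_sSmul hT]
    conv_rhs => rw [← Measure.map_id (μ := μ.restrict {x | 1 < K.nrm (x 0)})]
    refine Measure.map_congr ?_
    filter_upwards [ae_restrict_mem hU] with x hx
    exact K.sSmul_nrm_spectralMap (one_pos.trans hx)
  rw [← hinv ν, hmap, hinv ν']

end IsTailMeasure

end MeasCone

lemma ShiftInvariant.measure_preimage_seqShift {E : Type*} [MeasurableSpace E]
    {ν : Measure (ℤ → E)} (hs : ShiftInvariant ν) (k : ℤ) {A : Set (ℤ → E)}
    (hA : MeasurableSet A) : ν (seqShift k ⁻¹' A) = ν A := by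
  have himage : ∀ B : Set (ℤ → E), seqShift 1 '' B = seqShift (-1) ⁻¹' B := fun B =>
    congrFun (Set.image_eq_preimage_of_inverse (fun x => funext fun h => by simp [seqShift])
      (fun x => funext fun h => by simp [seqShift])) B
  have hcomp : ∀ (i j : ℤ) (B : Set (ℤ → E)),
      seqShift i ⁻¹' (seqShift j ⁻¹' B) = seqShift (i + j) ⁻¹' B := by
    intro i j B
    rw [← Set.preimage_comp]
    congr 1
    funext x h
    simp only [seqShift, Function.comp_apply]
    congr 1
    ring
  have hneg : ∀ j : ℤ, ν (seqShift (-1 + j) ⁻¹' A) = ν (seqShift j ⁻¹' A) := fun j => by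
    rw [← hcomp, ← himage, hs _ (MeasCone.measurable_seqShift j hA)]
  induction k using Int.induction_on with
  | zero =>
    congr 1
    ext x
    rw [Set.mem_preimage, show seqShift 0 x = x from funext fun h => by simp [seqShift]]
  | succ i ih => rw [← ih, ← hneg]; congr 3; ring
  | pred i ih => rw [← ih, ← hneg (-i)]; congr 3; ring

open MeasCone in
/-- a shift-invariant tail measure is determined by (the law of) its spectral
tail process. -/
theorem shiftInvariant_tailMeasure_eq_of_spectralLaw_eq
    {E : Type*} [MeasurableSpace E] (K : MeasCone E) (α : ℝ) (hα : 0 < α)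
    (ν ν' : Measure (ℤ → E))
    (hν : K.IsTailMeasure α ν) (hν' : K.IsTailMeasure α ν')
    (hs : ShiftInvariant ν) (hs' : ShiftInvariant ν')
    (hspec : K.spectralLaw ν 0 = K.spectralLaw ν' 0) :
    ν = ν' := by
  have hcone : ∀ (r : ℝ), 0 < r → ∀ (h : ℤ) (A : Set (ℤ → E)), MeasurableSet A →
      ν (A ∩ {x | r < K.nrm (x h)}) = ν' (A ∩ {x | r < K.nrm (x h)}) := by
    intro r hr h A hA
    have hset : seqShift (-h) ⁻¹' (seqShift h ⁻¹' A ∩ {x | r < K.nrm (x 0)}) =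
        A ∩ {x | r < K.nrm (x h)} := by
      ext x
      have hx : seqShift h (seqShift (-h) x) = x := by funext j; simp [seqShift]
      simp [hx]
      simp [seqShift]
    have hm := measurable_seqShift h hA
    have hm' := K.measurable_sSmul r hm
    have hr' := hm.inter (K.measurableSet_lt_nrm r 0)
    rw [← hset, hs.measure_preimage_seqShift _ hr', hs'.measure_preimage_seqShift _ hr',
      hν.measure_lt_nrm_inter hr 0 hm, hν'.measure_lt_nrm_inter hr 0 hm,
      ← Measure.restrict_apply hm', ← Measure.restrict_apply hm',
      hν.restrict_lt_nrm_eq hν' hspec]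
  let s : Option (ℕ × ℤ) → Set (ℤ → E) := fun o =>
    o.elim {K.zeroSeq} fun p => {x | 1 / ((p.1 : ℝ) + 1) < K.nrm (x p.2)}
  have hcover : ⋃ o, s o = Set.univ := by
    refine Set.eq_univ_of_forall fun x => Set.mem_iUnion.2 ?_
    by_cases hx : ∃ h, 0 < K.nrm (x h)
    · obtain ⟨h, hh⟩ := hx
      obtain ⟨n, hn⟩ := exists_nat_one_div_lt hh
      exact ⟨some (n, h), hn⟩
    · push Not at hx
      exact ⟨none, funext fun h => K.eq_zero_of_nrm _ ((hx h).antisymm (K.nrm_nonneg _))⟩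
  refine (Measure.ext_iff_of_iUnion_eq_univ hcover).2 ?_
  rintro (_ | ⟨n, h⟩)
  · change ν.restrict {K.zeroSeq} = ν'.restrict {K.zeroSeq}
    rw [Measure.restrict_eq_zero.2 hν.1, Measure.restrict_eq_zero.2 hν'.1]
  · refine Measure.ext fun A hA => ?_
    rw [Measure.restrict_apply hA, Measure.restrict_apply hA]
    exact hcone _ (by positivity) h A hA
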